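/- arXiv:1408.1729 — 5 statements merged into one kernel-verified Lean document; each statement's English description precedes it below -/
import Mathlib

section
/- For every discrete convex mesh function u_h and every x ∈ Ω_h, one has |∂¹_h u_h(x)| ≤ M⁰_h[u_h](x), where |·| denotes d-dimensional Lebesgue measure. -/
open MeasureTheory Filter
open scoped RealInnerProductSpace ENNReal Topology

noncomputable section

/-- `ℝ^d` with the Euclidean structure. -/
abbrev Ed (d : ℕ) := EuclideanSpace ℝ (Fin d)

/-- The lattice `ℤ^d_h = {mh : m ∈ ℤ^d}`. -/
def lat (d : ℕ) (h : ℝ) : Set (Ed d) :=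
  {x | ∃ m : Fin d → ℤ, ∀ i, x i = (m i : ℝ) * h}

/-- `e` is an orthogonal basis of `ℝ^d` (i.e. `d` pairwise orthogonal nonzero vectors),
with all `e i ∈ ℤ^d_h` and `x ± e i ∈ Ω̄ ∩ ℤ^d_h` for all `i`. -/
def admB (d : ℕ) (Ω : Set (Ed d)) (h : ℝ) (x : Ed d) (e : Fin d → Ed d) : Prop :=
  (∀ i, e i ∈ lat d h) ∧ (∀ i, e i ≠ 0) ∧
  (∀ i j, i ≠ j → ⟪e i, e j⟫ = 0) ∧
  (∀ i, x + e i ∈ closure Ω ∩ lat d h) ∧ (∀ i, x - e i ∈ closure Ω ∩ lat d h)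

/-- The first discrete normal mapping `∂¹_h u_h(x)`. -/
def subdiff1 (d : ℕ) (Ω : Set (Ed d)) (h : ℝ) (u : Ed d → ℝ) (x : Ed d) : Set (Ed d) :=
  {p | ∀ e : Fin d → Ed d, admB d Ω h x e → ∀ i,
    u x - u (x - e i) ≤ ⟪p, e i⟫ ∧ ⟪p, e i⟫ ≤ u (x + e i) - u x}

/-- `∂¹_h u_h(E) = ⋃_{x ∈ E ∩ ℤ^d_h} ∂¹_h u_h(x)`. -/
def subdiff1Set (d : ℕ) (Ω : Set (Ed d)) (h : ℝ) (u : Ed d → ℝ) (s : Set (Ed d)) :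
    Set (Ed d) :=
  ⋃ x ∈ s ∩ lat d h, subdiff1 d Ω h u x

/-- The second discrete normal mapping `∂²_h u_h(x)`. -/
def subdiff2 (d : ℕ) (Ω : Set (Ed d)) (h : ℝ) (u : Ed d → ℝ) (x : Ed d) : Set (Ed d) :=
  {p | ∀ e ∈ lat d h, x + e ∈ closure Ω ∩ lat d h → x - e ∈ closure Ω ∩ lat d h →
    u x - u (x - e) ≤ ⟪p, e⟫ ∧ ⟪p, e⟫ ≤ u (x + e) - u x}

/-- `∂²_h u_h(E) = ⋃_{x ∈ E ∩ ℤ^d_h} ∂²_h u_h(x)`. -/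
def subdiff2Set (d : ℕ) (Ω : Set (Ed d)) (h : ℝ) (u : Ed d → ℝ) (s : Set (Ed d)) :
    Set (Ed d) :=
  ⋃ x ∈ s ∩ lat d h, subdiff2 d Ω h u x

/-- The interior mesh points `Ω_h`. -/
def meshInt (d : ℕ) (Ω : Set (Ed d)) (h : ℝ) : Set (Ed d) :=
  {x ∈ Ω ∩ lat d h | ∀ i : Fin d,
    x + h • (EuclideanSpace.single i (1 : ℝ)) ∈ closure Ω ∩ lat d h ∧
    x - h • (EuclideanSpace.single i (1 : ℝ)) ∈ closure Ω ∩ lat d h}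

/-- A mesh function is discrete convex if `Δ_e u(x) ≥ 0` for all `x ∈ Ω_h` and all
admissible `e ∈ ℤ^d_h`. -/
def DiscConvex (d : ℕ) (Ω : Set (Ed d)) (h : ℝ) (u : Ed d → ℝ) : Prop :=
  ∀ x ∈ meshInt d Ω h, ∀ e ∈ lat d h,
    x + e ∈ closure Ω ∩ lat d h → x - e ∈ closure Ω ∩ lat d h →
    0 ≤ u (x + e) - 2 * u x + u (x - e)

/-- Oberman's discrete Monge–Ampère operator `M⁰_h[u](x)`. -/
def M0 (d : ℕ) (Ω : Set (Ed d)) (h : ℝ) (u : Ed d → ℝ) (x : Ed d) : ℝ :=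
  sInf {t | ∃ e : Fin d → Ed d, admB d Ω h x e ∧
    t = ∏ i, (u (x + e i) - 2 * u x + u (x - e i)) / ‖e i‖}

/-- The normal mapping (subdifferential) `∂u(x₀)` of `u : Ω → ℝ`. -/
def nmap (d : ℕ) (Ω : Set (Ed d)) (u : Ed d → ℝ) (x₀ : Ed d) : Set (Ed d) :=
  {p | ∀ x ∈ Ω, u x₀ + ⟪p, x - x₀⟫ ≤ u x}

/-- `∂u(E) = ⋃_{x ∈ E} ∂u(x)`. -/
def nmapSet (d : ℕ) (Ω : Set (Ed d)) (u : Ed d → ℝ) (s : Set (Ed d)) : Set (Ed d) :=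
  ⋃ x ∈ s, nmap d Ω u x

/-- The closed ball of radius `ε` around `x₀` in the maximum norm. -/
def ballMax (d : ℕ) (x₀ : Ed d) (ε : ℝ) : Set (Ed d) := {y | ∀ i, |y i - x₀ i| ≤ ε}

/-- The family of mesh functions `uh` converges to `u` uniformly on compact subsets of `Ω`. -/
def CvgUnifCpt (d : ℕ) (Ω : Set (Ed d)) (uh : ℝ → Ed d → ℝ) (u : Ed d → ℝ) : Prop :=
  ∀ K : Set (Ed d), K ⊆ Ω → IsCompact K →
    ∀ hk : ℕ → ℝ, (∀ n, 0 < hk n) → Tendsto hk atTop (𝓝 0) →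
    ∀ ε > (0 : ℝ), ∃ N : ℕ, ∀ n ≥ N, ∀ x ∈ K ∩ lat d (hk n), |uh (hk n) x - u x| < ε

/-- The boundary condition: for any positive sequence `h_k → 0`, any subsequence and any mesh
points `z_{k_j} ∈ Ω ∩ ℤ^d_{h_{k_j}}` converging to a boundary point,
`liminf u(z_{k_j}) ≤ limsup u_{h_{k_j}}(z_{k_j})`. -/
def BdryCond (d : ℕ) (Ω : Set (Ed d)) (uh : ℝ → Ed d → ℝ) (u : Ed d → ℝ) : Prop :=
  ∀ hk : ℕ → ℝ, (∀ n, 0 < hk n) → Tendsto hk atTop (𝓝 0) →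
  ∀ φ : ℕ → ℕ, StrictMono φ →
  ∀ z : ℕ → Ed d, (∀ j, z j ∈ Ω ∩ lat d (hk (φ j))) →
  ∀ z₀ ∈ frontier Ω, Tendsto z atTop (𝓝 z₀) →
    liminf (fun j => u (z j)) atTop ≤ limsup (fun j => uh (hk (φ j)) (z j)) atTop

/-- A box bounded by pairs of hyperplanes orthogonal to the nonzero, pairwise orthogonal vectors
`e i` has the volume of a rectangular parallelepiped. -/
theorem volume_setOf_inner_mem_Icc {d : ℕ} {e : Fin d → Ed d} (he : ∀ i, e i ≠ 0)
    (horth : ∀ i j, i ≠ j → ⟪e i, e j⟫ = 0) (a b : Fin d → ℝ) :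
    volume {p : Ed d | ∀ i, a i ≤ ⟪p, e i⟫ ∧ ⟪p, e i⟫ ≤ b i} =
      ∏ i, ENNReal.ofReal ((b i - a i) / ‖e i‖) := by
  have hpos : ∀ i, 0 < ‖e i‖ := fun i => norm_pos_iff.mpr (he i)
  have hon : Orthonormal ℝ fun i => ‖e i‖⁻¹ • e i := by
    refine ⟨fun i => ?_, fun i j hij => ?_⟩
    · rw [norm_smul, norm_inv, norm_norm, inv_mul_cancel₀ (hpos i).ne']
    · simp [inner_smul_left, inner_smul_right, horth i j hij]
  let B : OrthonormalBasis (Fin d) ℝ (Ed d) :=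
    (basisOfLinearIndependentOfCardEqFinrank' _ hon.linearIndependent
      (by simp)).toOrthonormalBasis (by simpa using hon)
  have hB : ∀ i, B i = ‖e i‖⁻¹ • e i := fun i => by simp [B]
  have hset : {p : Ed d | ∀ i, a i ≤ ⟪p, e i⟫ ∧ ⟪p, e i⟫ ≤ b i} =
      (fun p => WithLp.ofLp (B.repr p)) ⁻¹'
        Set.Icc (fun i => a i / ‖e i‖) (fun i => b i / ‖e i‖) := by
    ext p
    have hcoord : ∀ i, (B.repr p) i = ⟪p, e i⟫ / ‖e i‖ := fun i => by
      rw [B.repr_apply_apply, hB, real_inner_smul_left, real_inner_comm, div_eq_inv_mul]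
    simp only [Set.mem_ofPred_eq, Set.mem_preimage, Set.mem_Icc, Pi.le_def, ← forall_and,
      hcoord, div_le_div_iff_of_pos_right (hpos _)]
  have hmp : MeasurePreserving (fun p => WithLp.ofLp (B.repr p)) volume volume :=
    (PiLp.volume_preserving_ofLp (Fin d)).comp B.measurePreserving_repr
  rw [hset, hmp.measure_preimage measurableSet_Icc.nullMeasurableSet, Real.volume_Icc_pi]
  simp only [sub_div]

/-- The canonical basis scaled by `h` is admissible at every interior mesh point. -/
theorem admB_single {d : ℕ} {Ω : Set (Ed d)} {h : ℝ} (hh : h ≠ 0) {x : Ed d}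
    (hx : x ∈ meshInt d Ω h) :
    admB d Ω h x fun i => h • EuclideanSpace.single i (1 : ℝ) := by
  refine ⟨fun i => ⟨Pi.single i 1, fun j => ?_⟩, fun i => ?_, fun i j hij => ?_,
    fun i => (hx.2 i).1, fun i => (hx.2 i).2⟩
  · by_cases hji : j = i <;> simp [hji]
  · simp [hh]
  · simp [inner_smul_left, inner_smul_right, EuclideanSpace.inner_single_left, hij]

/-- `M¹_h[u](x) ≤ M⁰_h[u](x)`. -/
theorem stmt2 (d : ℕ) (hd : 0 < d) (h : ℝ) (hh : 0 < h) (Ω : Set (Ed d)) (hΩo : IsOpen Ω)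
    (hΩconv : Convex ℝ Ω) (hΩb : Bornology.IsBounded Ω) (u : Ed d → ℝ)
    (hu : DiscConvex d Ω h u) (x : Ed d) (hx : x ∈ meshInt d Ω h) :
    volume (subdiff1 d Ω h u x) ≤ ENNReal.ofReal (M0 d Ω h u x) := by
  have key : ∀ e, admB d Ω h x e → volume (subdiff1 d Ω h u x) ≤
      ENNReal.ofReal (∏ i, (u (x + e i) - 2 * u x + u (x - e i)) / ‖e i‖) := by
    intro e he
    have hnonneg : ∀ i, 0 ≤ (u (x + e i) - 2 * u x + u (x - e i)) / ‖e i‖ := fun i =>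
      div_nonneg (hu x hx (e i) (he.1 i) (he.2.2.2.1 i) (he.2.2.2.2 i)) (norm_nonneg _)
    rw [ENNReal.ofReal_prod_of_nonneg fun i _ => hnonneg i]
    calc volume (subdiff1 d Ω h u x)
        ≤ volume {p : Ed d | ∀ i, u x - u (x - e i) ≤ ⟪p, e i⟫ ∧ ⟪p, e i⟫ ≤ u (x + e i) - u x} :=
          measure_mono fun p hp => hp e he
      _ = _ := by
          rw [volume_setOf_inner_mem_Icc he.2.1 he.2.2.1]
          congr! 3
          ring
  have hcan := admB_single hh.ne' hx
  have hfin : volume (subdiff1 d Ω h u x) ≠ ∞ :=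
    ((key _ hcan).trans_lt ENNReal.ofReal_lt_top).ne
  rw [← ENNReal.ofReal_toReal hfin]
  refine ENNReal.ofReal_le_ofReal (le_csInf ⟨_, _, hcan, rfl⟩ ?_)
  rintro t ⟨e, he, rfl⟩
  refine ENNReal.toReal_le_of_le_ofReal (Finset.prod_nonneg fun i _ => ?_) (key e he)
  exact div_nonneg (hu x hx (e i) (he.1 i) (he.2.2.2.1 i) (he.2.2.2.2 i)) (norm_nonneg _)
end
end

section
/- The operator M¹_h is degenerate elliptic in the following sense: let x ∈ Ω ∩ ℤ^d_h and let v_h, w_h be mesh functions with v_h(x) ≤ w_h(x) and v_h(y) ≥ w_h(y) for every y ∈ Ω̄ ∩ ℤ^d_h with y ≠ x. Then ∂¹_h w_h(x) ⊆ ∂¹_h v_h(x), and consequently M¹_h[w_h](x) ≤ M¹_h[v_h](x). -/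
open MeasureTheory Filter
open scoped RealInnerProductSpace ENNReal Topology

noncomputable section

/-- `M¹_h` is degenerate elliptic. -/
theorem stmt4 (d : ℕ) (hd : 0 < d) (h : ℝ) (hh : 0 < h) (Ω : Set (Ed d)) (hΩo : IsOpen Ω)
    (hΩconv : Convex ℝ Ω) (hΩb : Bornology.IsBounded Ω)
    (x : Ed d) (hx : x ∈ Ω ∩ lat d h) (v w : Ed d → ℝ)
    (hvw : v x ≤ w x) (hyx : ∀ y ∈ closure Ω ∩ lat d h, y ≠ x → w y ≤ v y) :
    subdiff1 d Ω h w x ⊆ subdiff1 d Ω h v x ∧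
      volume (subdiff1 d Ω h w x) ≤ volume (subdiff1 d Ω h v x) := by
  have hsub : subdiff1 d Ω h w x ⊆ subdiff1 d Ω h v x := by
    intro p hp e he i
    obtain ⟨-, hne, -, hadd, hsubt⟩ := id he
    have hplus := hyx _ (hadd i) (by simpa using hne i)
    have hminus := hyx _ (hsubt i) (by simpa using hne i)
    obtain ⟨hlower, hupper⟩ := hp e he i
    constructor <;> linarith
  exact ⟨hsub, measure_mono hsub⟩
end
end

section
/- Let u_h be a family of mesh functions converging uniformly on compact subsets of Ω to a convex continuous function u : Ω → ℝ. Then for every compact K ⊂ Ω and every sequence h_k → 0, one has limsup_{k} ∂¹_{h_k} u_{h_k}(K) ⊆ ∂u(K), where limsup_{k} ∂¹_{h_k} u_{h_k}(K) = ∩_{n} ∪_{k ≥ n} ∂¹_{h_k} u_{h_k}(K). -/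
open MeasureTheory Filter
open scoped RealInnerProductSpace ENNReal Topology

noncomputable section

/-- A nonzero integer vector extends to a family of `d` nonzero pairwise orthogonal integer
vectors. -/
theorem exists_orthogonal_int_family {d : ℕ} (i₀ : Fin d) (m : Fin d → ℤ) (hm : m ≠ 0) :
    ∃ e : Fin d → Fin d → ℤ, e i₀ = m ∧ (∀ i, e i ≠ 0) ∧ ∀ i j, i ≠ j → e i ⬝ᵥ e j = 0 := by
  classical
  suffices H : ∀ s : Finset (Fin d), i₀ ∈ s → ∃ e : Fin d → Fin d → ℤ, e i₀ = m ∧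
      (∀ i ∈ s, e i ≠ 0) ∧ (∀ i ∉ s, e i = 0) ∧ ∀ i j, i ≠ j → e i ⬝ᵥ e j = 0 by
    obtain ⟨e, h0, h1, -, h2⟩ := H Finset.univ (Finset.mem_univ _)
    exact ⟨e, h0, fun i => h1 i (Finset.mem_univ _), h2⟩
  suffices H : ∀ s : Finset (Fin d), i₀ ∉ s → ∃ e : Fin d → Fin d → ℤ, e i₀ = m ∧
      (∀ i ∈ insert i₀ s, e i ≠ 0) ∧ (∀ i ∉ insert i₀ s, e i = 0) ∧
      ∀ i j, i ≠ j → e i ⬝ᵥ e j = 0 by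
    intro s hs
    simpa [Finset.insert_erase hs] using H (s.erase i₀) (Finset.notMem_erase _ _)
  intro s
  induction s using Finset.induction_on with
  | empty =>
    intro _
    refine ⟨Pi.single i₀ m, by simp, by simp [hm], ?_, ?_⟩
    · intro i hi
      simp only [Finset.mem_insert, Finset.notMem_empty, or_false] at hi
      simp [Pi.single_eq_of_ne hi]
    · intro i j hij
      by_cases hi : i = i₀
      · have hj : j ≠ i₀ := fun h => hij (hi.trans h.symm)
        simp [Pi.single_eq_of_ne hj]
      · simp [Pi.single_eq_of_ne hi]
  | insert a s ha ih =>
    intro hs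
    simp only [Finset.mem_insert, not_or] at hs
    obtain ⟨e, h0, h1, h2, h3⟩ := ih hs.2
    have hea : e a = 0 := h2 a (by simp [ha, Ne.symm hs.1])
    have hdet : (Matrix.of e).det = 0 :=
      Matrix.det_eq_zero_of_row_eq_zero a fun j => by simp [hea]
    obtain ⟨v, hv, hev⟩ := Matrix.exists_mulVec_eq_zero_iff.2 hdet
    have hort : ∀ i, e i ⬝ᵥ v = 0 := fun i => congrFun hev i
    refine ⟨Function.update e a v, by simp [Function.update_of_ne hs.1, h0], ?_, ?_, ?_⟩
    · intro i hi
      by_cases hia : i = a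
      · subst hia; simpa using hv
      · rw [Function.update_of_ne hia]
        apply h1
        simp only [Finset.mem_insert] at hi ⊢
        tauto
    · intro i hi
      simp only [Finset.mem_insert, not_or] at hi
      rw [Function.update_of_ne hi.2.1]
      exact h2 i (by simp [hi.1, hi.2.2])
    · intro i j hij
      by_cases hia : i = a
      · subst hia
        rw [Function.update_self, Function.update_of_ne hij.symm, dotProduct_comm]
        exact hort j
      · rw [Function.update_of_ne hia]
        by_cases hja : j = a
        · subst hja
          simpa using hort i
        · rw [Function.update_of_ne hja]
          exact h3 i j hij

theorem tendsto_mul_floor_div {h : ℕ → ℝ} (hpos : ∀ n, 0 < h n)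
    (h0 : Tendsto h atTop (𝓝 0)) (t : ℝ) :
    Tendsto (fun n => h n * (⌊t / h n⌋ : ℝ)) atTop (𝓝 t) := by
  have hlow : Tendsto (fun n => t - h n) atTop (𝓝 t) := by
    simpa using tendsto_const_nhds.sub h0
  refine tendsto_of_tendsto_of_tendsto_of_le_of_le hlow tendsto_const_nhds
    (fun n => ?_) (fun n => ?_)
  · have h1 := (Int.lt_floor_add_one (t / h n)).le
    rw [div_le_iff₀ (hpos n)] at h1
    simp only
    linarith
  · have h1 := Int.floor_le (t / h n)
    rw [le_div_iff₀ (hpos n)] at h1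
    simp only
    linarith

/-- An integer vector, viewed in Euclidean space. -/
def intVec {d : ℕ} (m : Fin d → ℤ) : Ed d := WithLp.toLp 2 fun i => (m i : ℝ)

theorem inner_intVec {d : ℕ} (m n : Fin d → ℤ) :
    ⟪intVec m, intVec n⟫ = ((m ⬝ᵥ n : ℤ) : ℝ) := by
  simp [intVec, PiLp.inner_apply, dotProduct, mul_comm]

theorem intVec_ne_zero {d : ℕ} {m : Fin d → ℤ} (hm : m ≠ 0) : intVec m ≠ 0 := by
  contrapose! hm
  ext i
  simpa [intVec] using congrArg (fun x : Ed d => x i) hm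

theorem smul_intVec_mem_lat {d : ℕ} (h : ℝ) (c : ℤ) (m : Fin d → ℤ) :
    (h * (c : ℝ)) • intVec m ∈ lat d h :=
  ⟨fun i => c * m i, fun i => by simp [intVec]; ring⟩

theorem add_mem_lat {d : ℕ} {h : ℝ} {x y : Ed d} (hx : x ∈ lat d h) (hy : y ∈ lat d h) :
    x + y ∈ lat d h := by
  obtain ⟨a, ha⟩ := hx
  obtain ⟨b, hb⟩ := hy
  exact ⟨fun i => a i + b i, fun i => by simp [ha, hb]; ring⟩

theorem sub_mem_lat {d : ℕ} {h : ℝ} {x y : Ed d} (hx : x ∈ lat d h) (hy : y ∈ lat d h) :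
    x - y ∈ lat d h := by
  obtain ⟨a, ha⟩ := hx
  obtain ⟨b, hb⟩ := hy
  exact ⟨fun i => a i - b i, fun i => by simp [ha, hb]; ring⟩

/-- Uniform convergence on compact sets implies continuous convergence along mesh points. -/
theorem CvgUnifCpt.tendsto {d : ℕ} {Ω : Set (Ed d)} (hΩo : IsOpen Ω)
    {uh : ℝ → Ed d → ℝ} {u : Ed d → ℝ} (hu : ContinuousOn u Ω) (hcvg : CvgUnifCpt d Ω uh u)
    {h : ℕ → ℝ} (hpos : ∀ n, 0 < h n) (h0 : Tendsto h atTop (𝓝 0))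
    {y : ℕ → Ed d} {z : Ed d} (hz : z ∈ Ω) (hy : Tendsto y atTop (𝓝 z))
    (hlat : ∀ n, y n ∈ lat d (h n)) :
    Tendsto (fun n => uh (h n) (y n)) atTop (𝓝 (u z)) := by
  obtain ⟨r, hr, hball⟩ := Metric.nhds_basis_closedBall.mem_iff.1 (hΩo.mem_nhds hz)
  have huy : Tendsto (fun n => u (y n)) atTop (𝓝 (u z)) :=
    (hu.continuousAt (hΩo.mem_nhds hz)).tendsto.comp hy
  have hdiff : Tendsto (fun n => uh (h n) (y n) - u (y n)) atTop (𝓝 0) := by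
    rw [Metric.tendsto_atTop']
    intro ε hε
    obtain ⟨N, hN⟩ := hcvg _ hball (isCompact_closedBall z r) h hpos h0 ε hε
    obtain ⟨M, hM⟩ := eventually_atTop.1 (hy (Metric.closedBall_mem_nhds z hr))
    refine ⟨max N M, fun n hn => ?_⟩
    rw [Real.dist_eq, sub_zero]
    exact hN n ((le_max_left _ _).trans hn.le) _ ⟨hM n ((le_max_right _ _).trans hn.le), hlat n⟩
  simpa using hdiff.add huy

/-- A limit of points with `p` in their discrete normal mapping satisfies the subgradient
inequality along integer directions. -/
theorem inner_le_of_mem_subdiff1 {d : ℕ} (i₀ : Fin d) {Ω : Set (Ed d)} (hΩo : IsOpen Ω)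
    {uh : ℝ → Ed d → ℝ} {u : Ed d → ℝ} (hu : ContinuousOn u Ω) (hcvg : CvgUnifCpt d Ω uh u)
    {h : ℕ → ℝ} (hpos : ∀ n, 0 < h n) (h0 : Tendsto h atTop (𝓝 0))
    {x : ℕ → Ed d} {x₀ p : Ed d} (hx₀ : x₀ ∈ Ω) (hx : Tendsto x atTop (𝓝 x₀))
    (hlat : ∀ n, x n ∈ lat d (h n)) (hp : ∀ n, p ∈ subdiff1 d Ω (h n) (uh (h n)) (x n))
    (m : Fin d → ℤ) {t : ℝ} (ht : 0 < t)
    (hadd : x₀ + t • intVec m ∈ Ω) (hsub : x₀ - t • intVec m ∈ Ω) :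
    ⟪p, t • intVec m⟫ ≤ u (x₀ + t • intVec m) - u x₀ := by
  rcases eq_or_ne m 0 with rfl | hm
  · have : intVec (0 : Fin d → ℤ) = 0 := by ext i; simp [intVec]
    simp [this]
  obtain ⟨b, hb0, hbne, hbort⟩ := exists_orthogonal_int_family i₀ m hm
  let c : ℕ → Fin d → ℤ := fun n i => if i = i₀ then ⌊t / h n⌋ else 1
  let e : ℕ → Fin d → Ed d := fun n i => (h n * (c n i : ℝ)) • intVec (b i)
  have hc : ∀ i, Tendsto (fun n => h n * (c n i : ℝ)) atTop (𝓝 (if i = i₀ then t else 0)) := by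
    intro i
    by_cases hi : i = i₀
    · simpa [c, hi] using tendsto_mul_floor_div hpos h0 t
    · simpa [c, hi] using h0
  have he : ∀ i, Tendsto (fun n => e n i) atTop
      (𝓝 ((if i = i₀ then t else 0) • intVec (b i))) := fun i => (hc i).smul_const _
  have helat : ∀ n i, e n i ∈ lat d (h n) := fun n i => smul_intVec_mem_lat _ _ _
  have hlim_add : ∀ i, x₀ + (if i = i₀ then t else 0) • intVec (b i) ∈ Ω := by
    intro i
    by_cases hi : i = i₀
    · simpa [hi, hb0] using hadd
    · simpa [hi] using hx₀
  have hlim_sub : ∀ i, x₀ - (if i = i₀ then t else 0) • intVec (b i) ∈ Ω := by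
    intro i
    by_cases hi : i = i₀
    · simpa [hi, hb0] using hsub
    · simpa [hi] using hx₀
  have hev_add : ∀ᶠ n in atTop, ∀ i, x n + e n i ∈ Ω :=
    eventually_all.2 fun i => (hx.add (he i)) (hΩo.mem_nhds (hlim_add i))
  have hev_sub : ∀ᶠ n in atTop, ∀ i, x n - e n i ∈ Ω :=
    eventually_all.2 fun i => (hx.sub (he i)) (hΩo.mem_nhds (hlim_sub i))
  have hev_ne : ∀ᶠ n in atTop, ∀ i, e n i ≠ 0 := by
    refine eventually_all.2 fun i => ?_
    have hcoef : ∀ᶠ n in atTop, h n * (c n i : ℝ) ≠ 0 := by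
      by_cases hi : i = i₀
      · have := hc i
        rw [if_pos hi] at this
        exact this.eventually_ne ht.ne'
      · exact Eventually.of_forall fun n => by simp [c, hi, (hpos n).ne']
    filter_upwards [hcoef] with n hn
    exact smul_ne_zero hn (intVec_ne_zero (hbne i))
  have hmain : ∀ᶠ n in atTop,
      ⟪p, e n i₀⟫ ≤ uh (h n) (x n + e n i₀) - uh (h n) (x n) := by
    filter_upwards [hev_add, hev_sub, hev_ne] with n h1 h2 h3
    refine (hp n (e n) ⟨helat n, h3, fun i j hij => ?_, fun i => ?_, fun i => ?_⟩ i₀).2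
    · simp only [e]
      rw [real_inner_smul_left, real_inner_smul_right, inner_intVec, hbort i j hij]
      simp
    · exact ⟨subset_closure (h1 i), add_mem_lat (hlat n) (helat n i)⟩
    · exact ⟨subset_closure (h2 i), sub_mem_lat (hlat n) (helat n i)⟩
  have he₀ : Tendsto (fun n => e n i₀) atTop (𝓝 (t • intVec m)) := by
    simpa [hb0] using he i₀
  exact le_of_tendsto_of_tendsto (tendsto_const_nhds.inner he₀)
    ((hcvg.tendsto hΩo hu hpos h0 hadd (hx.add he₀)
        fun n => add_mem_lat (hlat n) (helat n i₀)).sub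
      (hcvg.tendsto hΩo hu hpos h0 hx₀ hx hlat)) hmain

/-- Every vector is a limit of scaled integer vectors. -/
theorem tendsto_smul_intVec_floor {d : ℕ} {s : ℕ → ℝ} (hpos : ∀ n, 0 < s n)
    (h0 : Tendsto s atTop (𝓝 0)) (v : Ed d) :
    Tendsto (fun n => s n • intVec fun i => ⌊v i / s n⌋) atTop (𝓝 v) := by
  have hpi : Tendsto (fun n i => s n * (⌊v i / s n⌋ : ℝ)) atTop (𝓝 (WithLp.ofLp v)) :=
    tendsto_pi_nhds.2 fun i => tendsto_mul_floor_div hpos h0 (v i)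
  exact ((PiLp.continuous_toLp 2 fun _ : Fin d => ℝ).tendsto _).comp hpi

/-- upper weak-convergence inclusion for `∂¹`. -/
theorem stmt9 (d : ℕ) (hd : 0 < d) (Ω : Set (Ed d)) (hΩo : IsOpen Ω)
    (hΩconv : Convex ℝ Ω) (hΩb : Bornology.IsBounded Ω)
    (uh : ℝ → Ed d → ℝ) (u : Ed d → ℝ)
    (hu_cont : ContinuousOn u Ω) (hu_conv : ConvexOn ℝ Ω u)
    (hcvg : CvgUnifCpt d Ω uh u)
    (K : Set (Ed d)) (hKΩ : K ⊆ Ω) (hKc : IsCompact K)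
    (hk : ℕ → ℝ) (hkpos : ∀ n, 0 < hk n) (hk0 : Tendsto hk atTop (𝓝 0)) :
    (⋂ n : ℕ, ⋃ k : ℕ, ⋃ _ : n ≤ k, subdiff1Set d Ω (hk k) (uh (hk k)) K)
      ⊆ nmapSet d Ω u K := by
  intro p hp
  simp only [Set.mem_iInter, Set.mem_iUnion, exists_prop] at hp
  have hfreq : ∃ᶠ k in atTop, p ∈ subdiff1Set d Ω (hk k) (uh (hk k)) K :=
    frequently_atTop.2 hp
  obtain ⟨φ, hφ, hpφ⟩ := extraction_of_frequently_atTop hfreq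
  simp only [subdiff1Set, Set.mem_iUnion, exists_prop] at hpφ
  choose x hxmem hxp using hpφ
  obtain ⟨x₀, hx₀K, ψ, hψ, hxlim⟩ := hKc.tendsto_subseq fun n => (hxmem n).1
  have hx₀ : x₀ ∈ Ω := hKΩ hx₀K
  have hdir : ∀ (m : Fin d → ℤ) (t : ℝ), 0 < t → x₀ + t • intVec m ∈ Ω →
      x₀ - t • intVec m ∈ Ω → ⟪p, t • intVec m⟫ ≤ u (x₀ + t • intVec m) - u x₀ :=
    fun m t ht => inner_le_of_mem_subdiff1 ⟨0, hd⟩ hΩo hu_cont hcvg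
      (h := fun n => hk (φ (ψ n))) (fun n => hkpos _)
      (hk0.comp (hφ.tendsto_atTop.comp hψ.tendsto_atTop)) hx₀ hxlim
      (fun n => (hxmem (ψ n)).2) (fun n => hxp (ψ n)) m ht
  have hlocal : ∀ v : Ed d, x₀ + v ∈ Ω → x₀ - v ∈ Ω → ⟪p, v⟫ ≤ u (x₀ + v) - u x₀ := by
    intro v hadd hsub
    have hs : ∀ n : ℕ, (0 : ℝ) < 1 / ((n : ℝ) + 1) := fun n => Nat.one_div_pos_of_nat
    have hv := tendsto_smul_intVec_floor hs tendsto_one_div_add_atTop_nhds_zero_nat v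
    have hxadd := hv.const_add x₀
    have hxsub := hv.const_sub x₀
    refine le_of_tendsto_of_tendsto (tendsto_const_nhds.inner hv)
      (((hu_cont.continuousAt (hΩo.mem_nhds hadd)).tendsto.comp hxadd).sub_const (u x₀)) ?_
    filter_upwards [hxadd (hΩo.mem_nhds hadd), hxsub (hΩo.mem_nhds hsub)] with n h1 h2
    exact hdir _ _ (hs n) h1 h2
  have hconv : ConvexOn ℝ Ω fun y => u y - ⟪p, y⟫ :=
    hu_conv.sub ((innerSL ℝ p).toLinearMap.concaveOn hΩconv)
  have hmin : IsMinOn (fun y => u y - ⟪p, y⟫) Ω x₀ := by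
    refine IsMinOn.of_isLocalMinOn_of_convexOn hx₀ (IsLocalMin.on ?_ Ω) hconv
    have hrefl : Tendsto (fun y => x₀ - (y - x₀)) (𝓝 x₀) (𝓝 x₀) := by
      have : Continuous fun y : Ed d => x₀ - (y - x₀) := by fun_prop
      simpa using this.tendsto x₀
    filter_upwards [hΩo.mem_nhds hx₀, hrefl (hΩo.mem_nhds hx₀)] with y hy hy'
    have := hlocal (y - x₀) (by simpa using hy) hy'
    rw [add_sub_cancel, inner_sub_right] at this
    linarith
  simp only [nmapSet, Set.mem_iUnion, exists_prop]
  refine ⟨x₀, hx₀K, fun y hy => ?_⟩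
  have := isMinOn_iff.1 hmin y hy
  rw [inner_sub_right]
  linarith
end
end

section
/- The operator M²_h is degenerate elliptic in the following sense: let x ∈ Ω ∩ ℤ^d_h and let v_h, w_h be mesh functions with v_h(x) ≤ w_h(x) and v_h(y) ≥ w_h(y) for every y ∈ Ω̄ ∩ ℤ^d_h with y ≠ x. Then ∂²_h w_h(x) ⊆ ∂²_h v_h(x), and consequently M²_h[w_h](x) ≤ M²_h[v_h](x). -/
open MeasureTheory Filter
open scoped RealInnerProductSpace ENNReal Topology

noncomputable section

/-- The second discrete normal mapping at `x` grows when the value at `x` decreases and the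
values at the other mesh points increase. -/
theorem subdiff2_subset {d : ℕ} {Ω : Set (Ed d)} {h : ℝ} {x : Ed d} {v w : Ed d → ℝ}
    (hvw : v x ≤ w x) (hyx : ∀ y ∈ closure Ω ∩ lat d h, y ≠ x → w y ≤ v y) :
    subdiff2 d Ω h w x ⊆ subdiff2 d Ω h v x := by
  intro p hp e he hadd hsub
  rcases eq_or_ne e 0 with rfl | he0
  · simp
  · obtain ⟨h1, h2⟩ := hp e he hadd hsub
    have h3 := hyx _ hadd (by simpa using he0)
    have h4 := hyx _ hsub (by simpa using he0)
    constructor <;> linarith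

/-- `M²_h` is degenerate elliptic. -/
theorem stmt13 (d : ℕ) (hd : 0 < d) (h : ℝ) (hh : 0 < h) (Ω : Set (Ed d)) (hΩo : IsOpen Ω)
    (hΩconv : Convex ℝ Ω) (hΩb : Bornology.IsBounded Ω)
    (x : Ed d) (hx : x ∈ Ω ∩ lat d h) (v w : Ed d → ℝ)
    (hvw : v x ≤ w x) (hyx : ∀ y ∈ closure Ω ∩ lat d h, y ≠ x → w y ≤ v y) :
    subdiff2 d Ω h w x ⊆ subdiff2 d Ω h v x ∧
      volume (subdiff2 d Ω h w x) ≤ volume (subdiff2 d Ω h v x) := by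
  exact ⟨subdiff2_subset hvw hyx, measure_mono (subdiff2_subset hvw hyx)⟩
end
end

section
/- Let (u_h)_{h>0} be a family of discrete convex mesh functions that is uniformly bounded, i.e. there is B > 0 with |u_h(x)| ≤ B for all h > 0 and all x ∈ Ω̄ ∩ ℤ^d_h. Then the family is locally equicontinuous: for each compact subset K ⊂ Ω there exists a constant C_K > 0, independent of h, such that |u_h(x) − u_h(y)| ≤ C_K |x − y| for all h > 0 and all x, y ∈ K ∩ ℤ^d_h. -/
open MeasureTheory Filter
open scoped RealInnerProductSpace ENNReal Topology

noncomputable section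

/-- A finite sequence with nonnegative second differences grows at least linearly, with slope its
first increment. -/
theorem mul_sub_le_sub_of_second_diff_nonneg (a : ℕ → ℝ) (n : ℕ)
    (ha : ∀ k, k + 1 < n → 0 ≤ a (k + 2) - 2 * a (k + 1) + a k) :
    (n : ℝ) * (a 1 - a 0) ≤ a n - a 0 := by
  have hinc : ∀ k, k < n → a 1 - a 0 ≤ a (k + 1) - a k := by
    intro k
    induction k with
    | zero => intro _; simp
    | succ k ih =>
      intro hk
      have h1 := ih (by omega)
      have h2 := ha k hk
      linarith
  have hsum : ∀ k, k ≤ n → (k : ℝ) * (a 1 - a 0) ≤ a k - a 0 := by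
    intro k
    induction k with
    | zero => intro _; simp
    | succ k ih =>
      intro hk
      have h1 := ih (by omega)
      have h2 := hinc k (by omega)
      push_cast
      linarith
  exact hsum n le_rfl

theorem natCast_smul_mem_lat {d : ℕ} {h : ℝ} {x : Ed d} (hx : x ∈ lat d h) (k : ℕ) :
    (k : ℝ) • x ∈ lat d h := by
  obtain ⟨m, hm⟩ := hx
  exact ⟨fun i => k * m i, fun i => by simp [hm i, mul_assoc]⟩

theorem smul_single_mem_lat (d : ℕ) (h : ℝ) (i : Fin d) :
    h • (EuclideanSpace.single i (1 : ℝ)) ∈ lat d h := by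
  refine ⟨Pi.single i 1, fun j => ?_⟩
  by_cases hij : j = i
  · subst hij; simp
  · simp [hij]

/-- Nonzero lattice vectors have length at least the mesh size. -/
theorem le_norm_of_mem_lat {d : ℕ} {h : ℝ} (hh : 0 < h) {e : Ed d} (he : e ∈ lat d h)
    (he0 : e ≠ 0) : h ≤ ‖e‖ := by
  obtain ⟨m, hm⟩ := he
  obtain ⟨i, hi⟩ : ∃ i, e i ≠ 0 := by
    by_contra! hc
    exact he0 (by ext i; simpa using hc i)
  have hmi : m i ≠ 0 := by
    rintro h0
    exact hi (by simp [hm i, h0])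
  have h1 : (1 : ℝ) ≤ |(m i : ℝ)| := by exact_mod_cast Int.one_le_abs hmi
  calc h ≤ |(m i : ℝ)| * h := le_mul_of_one_le_left hh.le h1
    _ = ‖e i‖ := by rw [hm i, Real.norm_eq_abs, abs_mul, abs_of_pos hh]
    _ ≤ ‖e‖ := PiLp.norm_apply_le e i

/-- A lattice point around which `Ω` contains a ball of radius `h` is an interior mesh point. -/
theorem mem_meshInt_of_closedBall_subset {d : ℕ} {Ω : Set (Ed d)} {h : ℝ} (hh : 0 < h)
    {x : Ed d} (hx : x ∈ lat d h) (hball : Metric.closedBall x h ⊆ Ω) : x ∈ meshInt d Ω h := by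
  refine ⟨⟨hball (Metric.mem_closedBall_self hh.le), hx⟩, fun i => ⟨⟨?_, ?_⟩, ?_, ?_⟩⟩
  · exact subset_closure (hball (by simp [norm_smul, abs_of_pos hh]))
  · exact add_mem_lat hx (smul_single_mem_lat d h i)
  · exact subset_closure (hball (by
      simp [Metric.mem_closedBall, norm_smul, abs_of_pos hh]))
  · exact sub_mem_lat hx (smul_single_mem_lat d h i)

/-- One-sided Lipschitz estimate for a bounded discrete convex mesh function at a lattice point
whose distance to the complement of `Ω` is at least `δ`. -/
theorem DiscConvex.add_sub_le {d : ℕ} {Ω : Set (Ed d)} {h : ℝ} (hh : 0 < h) {u : Ed d → ℝ}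
    (hu : DiscConvex d Ω h u) {B : ℝ} (hB : 0 < B)
    (hbdd : ∀ x ∈ closure Ω ∩ lat d h, |u x| ≤ B) {δ : ℝ} (hδ : 0 < δ) {x e : Ed d}
    (hx : x ∈ lat d h) (he : e ∈ lat d h) (hball : Metric.closedBall x δ ⊆ Ω)
    (hxe : x + e ∈ Ω) : u (x + e) - u x ≤ 8 * B / δ * ‖e‖ := by
  by_cases he0 : e = 0
  · simp [he0]
  have hepos : 0 < ‖e‖ := norm_pos_iff.2 he0
  have hxΩ : x ∈ Ω := hball (Metric.mem_closedBall_self hδ.le)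
  have hux := abs_le.1 (hbdd x ⟨subset_closure hxΩ, hx⟩)
  rcases lt_or_ge (δ / 2) ‖e‖ with hbig | hsmall
  · have huxe := abs_le.1 (hbdd (x + e) ⟨subset_closure hxe, add_mem_lat hx he⟩)
    have : 4 * B ≤ 8 * B / δ * ‖e‖ := by
      rw [div_mul_eq_mul_div, le_div_iff₀ hδ]
      nlinarith
    linarith
  have hhe := le_norm_of_mem_lat hh he he0
  set n := ⌊δ / (2 * ‖e‖)⌋₊
  have hq1 : 1 ≤ δ / (2 * ‖e‖) := by
    rw [le_div_iff₀ (by positivity)]; linarith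
  have hn1 : (1 : ℝ) ≤ n := by exact_mod_cast Nat.one_le_floor_iff _ |>.2 hq1
  have hnle : (n : ℝ) * ‖e‖ ≤ δ / 2 := by
    have h1 : (n : ℝ) ≤ δ / (2 * ‖e‖) := Nat.floor_le (by positivity)
    rw [le_div_iff₀ (by positivity)] at h1
    linarith
  have hnge : δ ≤ 4 * n * ‖e‖ := by
    have h1 : δ / (2 * ‖e‖) < n + 1 := Nat.lt_floor_add_one _
    rw [div_lt_iff₀ (by positivity)] at h1
    nlinarith
  have hlat : ∀ k : ℕ, x + (k : ℝ) • e ∈ lat d h := fun k =>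
    add_mem_lat hx (natCast_smul_mem_lat he k)
  have hnear : ∀ k ≤ n, ‖(k : ℝ) • e‖ ≤ δ / 2 := by
    intro k hk
    have hk' : (k : ℝ) ≤ n := by exact_mod_cast hk
    rw [norm_smul, Real.norm_natCast]
    nlinarith
  have hcl : ∀ k ≤ n, x + (k : ℝ) • e ∈ closure Ω ∩ lat d h := by
    intro k hk
    refine ⟨subset_closure (hball ?_), hlat k⟩
    have := hnear k hk
    rw [mem_closedBall_iff_norm, add_sub_cancel_left]
    linarith
  have hint : ∀ k ≤ n, x + (k : ℝ) • e ∈ meshInt d Ω h := by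
    intro k hk
    refine mem_meshInt_of_closedBall_subset hh (hlat k) (subset_trans ?_ hball)
    refine Metric.closedBall_subset_closedBall' ?_
    have := hnear k hk
    rw [dist_eq_norm, add_sub_cancel_left]
    linarith
  have hgrow := mul_sub_le_sub_of_second_diff_nonneg (fun k : ℕ => u (x + (k : ℝ) • e)) n (by
    intro k hk
    have hp : x + ((k + 1 : ℕ) : ℝ) • e + e = x + ((k + 2 : ℕ) : ℝ) • e := by
      push_cast; module
    have hm : x + ((k + 1 : ℕ) : ℝ) • e - e = x + (k : ℝ) • e := by
      push_cast; module
    have h2 := hu _ (hint (k + 1) hk.le) e he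
      (by rw [hp]; exact hcl _ (by omega)) (by rw [hm]; exact hcl _ (by omega))
    rwa [hp, hm] at h2)
  have hun := abs_le.1 (hbdd _ (hcl n le_rfl))
  simp only [Nat.cast_one, one_smul, Nat.cast_zero, zero_smul, add_zero] at hgrow
  have hle : (n : ℝ) * (u (x + e) - u x) ≤ n * (8 * B / δ * ‖e‖) := by
    have : 2 * B ≤ n * (8 * B / δ * ‖e‖) := by
      rw [show (n : ℝ) * (8 * B / δ * ‖e‖) = 2 * B * (4 * n * ‖e‖) / δ by ring,
        le_div_iff₀ hδ]
      exact mul_le_mul_of_nonneg_left hnge (by positivity)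
    linarith
  exact le_of_mul_le_mul_left hle (by linarith)

/-- uniformly bounded discrete convex mesh functions are locally
equicontinuous. -/
theorem stmt17 (d : ℕ) (hd : 0 < d) (Ω : Set (Ed d)) (hΩo : IsOpen Ω)
    (hΩconv : Convex ℝ Ω) (hΩb : Bornology.IsBounded Ω)
    (uh : ℝ → Ed d → ℝ) (hdc : ∀ h : ℝ, 0 < h → DiscConvex d Ω h (uh h))
    (B : ℝ) (hB : 0 < B)
    (hbdd : ∀ h : ℝ, 0 < h → ∀ x ∈ closure Ω ∩ lat d h, |uh h x| ≤ B)
    (K : Set (Ed d)) (hKΩ : K ⊆ Ω) (hKc : IsCompact K) :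
    ∃ C : ℝ, 0 < C ∧ ∀ h : ℝ, 0 < h →
      ∀ x ∈ K ∩ lat d h, ∀ y ∈ K ∩ lat d h, |uh h x - uh h y| ≤ C * ‖x - y‖ := by
  obtain ⟨δ, hδ, hsub⟩ := hKc.exists_cthickening_subset_open hΩo hKΩ
  have hball : ∀ x ∈ K, Metric.closedBall x δ ⊆ Ω := fun x hx =>
    (Metric.closedBall_subset_cthickening hx δ).trans hsub
  refine ⟨8 * B / δ, by positivity, fun h hh => ?_⟩
  have key : ∀ x ∈ K ∩ lat d h, ∀ y ∈ K ∩ lat d h,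
      uh h x - uh h y ≤ 8 * B / δ * ‖x - y‖ := by
    rintro x ⟨hxK, hxl⟩ y ⟨hyK, hyl⟩
    have := (hdc h hh).add_sub_le hh hB (hbdd h hh) hδ hyl (sub_mem_lat hxl hyl) (hball y hyK)
      (by rw [add_sub_cancel]; exact hKΩ hxK)
    rwa [add_sub_cancel] at this
  intro x hx y hy
  refine abs_sub_le_iff.2 ⟨key x hx y hy, ?_⟩
  rw [norm_sub_rev]
  exact key y hy x hx
end
end
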